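/- Fix an integer l with |l| < l₁, an integer N > 2l₁, a function v : ℤ → ℂ, and an admissible sequence d. Then for every real s > 0 the series G(s) = Σ_{k=-l₁+1}^{l₁-1} Σ_{m ≥ max(N, k+l₁)} q^{-m} d_m q^{m/2} c^{-m} v(k) · (q^{s(|k+l| + m - k - l)} - q^{s(|k| + m - k)}) converges absolutely, and lim_{s→0⁺} s·G(s) = 0. -/

import Mathlib

open Filter Topology

noncomputable section

/-- `qc q x` is the real power `q ^ x`, viewed as a complex number. -/
def qc (q : ℝ) (x : ℝ) : ℂ := ((q ^ x : ℝ) : ℂ)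

/-- An admissible sequence: `d m = q^(m/2) (c₁ c^m + c₂ c^(-m))` for all `m ≥ l₁`. -/
def IsAdmissibleSeq (q : ℝ) (c : ℂ) (l₁ : ℤ) (d : ℕ → ℂ) : Prop :=
  ∃ c₁ c₂ : ℂ, ∀ m : ℕ, l₁ ≤ (m : ℤ) →
    d m = qc q ((m : ℝ) / 2) * (c₁ * c ^ (m : ℤ) + c₂ * c ^ (-(m : ℤ)))

/-- An admissible family on `ℤ × ℕ`, given by region asymptotics. -/
def IsAdmissibleFam (q : ℝ) (l₁ : ℤ) (a : ℤ → ℕ → ℂ) : Prop :=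
  ∃ (k₁ k₂ k₃ : ℂ) (A B : ℤ → ℂ), ∀ (n : ℤ) (m : ℕ),
    (l₁ ≤ n → a n m = k₁) ∧
    (-l₁ < n → n < l₁ → l₁ ≤ n + (m : ℤ) → a n m = A n) ∧
    (n ≤ -l₁ → l₁ ≤ n + (m : ℤ) → a n m = qc q (-(n : ℝ)) * k₂) ∧
    (n ≤ -l₁ → -l₁ < n + (m : ℤ) → n + (m : ℤ) < l₁ →
      a n m = qc q (-(n : ℝ)) * B (n + m)) ∧
    (n + (m : ℤ) ≤ -l₁ → a n m = qc q (-(2 * (n : ℝ) + (m : ℝ))) * k₃)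

/-- An `l`-stabilized family on `ℤ × ℕ` (the regions do not depend on `l`). -/
def IsStabilizedFam (q : ℝ) (c : ℂ) (l₁ : ℤ) (e : ℤ → ℕ → ℂ) : Prop :=
  ∃ (u w : ℂ) (f v : ℤ → ℂ) (N : ℤ), 2 * l₁ < N ∧ ∀ (n : ℤ) (m : ℕ),
    (l₁ ≤ n → e n m = (c ^ 2 * (q : ℂ)) ^ n * (c * qc q (1 / 2)) ^ m * u) ∧
    (-l₁ < n → n < l₁ → N ≤ (m : ℤ) → e n m = (c * qc q (1 / 2)) ^ m * f n) ∧
    (n ≤ -l₁ → -l₁ < n + (m : ℤ) → n + (m : ℤ) < l₁ → N ≤ (m : ℤ) →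
      e n m = qc q ((m : ℝ) / 2) * c ^ (-(m : ℤ)) * v (n + m)) ∧
    (n + (m : ℤ) ≤ -l₁ → e n m = (c ^ 2 * (q : ℂ)⁻¹) ^ n * (c * qc q (-(1 / 2))) ^ m * w)

theorem norm_qc {q : ℝ} (hq : 0 < q) (x : ℝ) : ‖qc q x‖ = q ^ x := by
  rw [qc, Complex.norm_real, Real.norm_of_nonneg (Real.rpow_nonneg hq.le x)]

theorem qc_mul {q : ℝ} (hq : 0 < q) (x y : ℝ) : qc q x * qc q y = qc q (x + y) := by
  simp only [qc, Real.rpow_add hq, Complex.ofReal_mul]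

theorem qc_zero (q : ℝ) : qc q 0 = 1 := by
  simp [qc]

/-- The weight `q ^ (-m) d m q ^ (m / 2)` of an admissible sequence is bounded. -/
theorem IsAdmissibleSeq.exists_norm_le {q : ℝ} (hq : 0 < q) {c : ℂ} (hc : ‖c‖ = 1) {l₁ : ℤ}
    {d : ℕ → ℂ} (hd : IsAdmissibleSeq q c l₁ d) :
    ∃ C : ℝ, ∀ m : ℕ, l₁ ≤ (m : ℤ) → ‖qc q (-(m : ℝ)) * d m * qc q ((m : ℝ) / 2)‖ ≤ C := by
  obtain ⟨c₁, c₂, hd⟩ := hd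
  refine ⟨‖c₁‖ + ‖c₂‖, fun m hm => ?_⟩
  have hone : qc q (-(m : ℝ)) * qc q ((m : ℝ) / 2) * qc q ((m : ℝ) / 2) = 1 := by
    rw [qc_mul hq, qc_mul hq, ← qc_zero q]
    ring_nf
  have hweight : qc q (-(m : ℝ)) * d m * qc q ((m : ℝ) / 2) =
      c₁ * c ^ (m : ℤ) + c₂ * c ^ (-(m : ℤ)) := by
    rw [hd m hm]
    linear_combination (c₁ * c ^ (m : ℤ) + c₂ * c ^ (-(m : ℤ))) * hone
  rw [hweight]
  refine (norm_add_le _ _).trans_eq ?_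
  simp only [norm_mul, norm_zpow, hc, one_zpow, mul_one]

/-- Comparison with a geometric series, for families indexed by a set of natural numbers. -/
theorem summable_norm_and_norm_tsum_le_of_geometric {E : Type*} [NormedAddCommGroup E]
    {p : ℕ → Prop} {f : {m : ℕ // p m} → E} {D r : ℝ} (hD : 0 ≤ D) (hr0 : 0 ≤ r) (hr1 : r < 1)
    (hf : ∀ m, ‖f m‖ ≤ D * r ^ m.1) :
    (Summable fun m => ‖f m‖) ∧ ‖∑' m, f m‖ ≤ D * (1 - r)⁻¹ := by
  have hg : Summable fun m : ℕ => D * r ^ m :=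
    (summable_geometric_of_lt_one hr0 hr1).mul_left D
  have hsub : Summable fun m : {m : ℕ // p m} => D * r ^ m.1 := hg.subtype {m | p m}
  refine ⟨.of_nonneg_of_le (fun _ => norm_nonneg _) hf hsub, ?_⟩
  calc ‖∑' m, f m‖ ≤ ∑' m : {m : ℕ // p m}, D * r ^ m.1 :=
        tsum_of_norm_bounded hsub.hasSum hf
    _ ≤ ∑' m : ℕ, D * r ^ m :=
        hg.tsum_subtype_le (fun m : ℕ => D * r ^ m) {m | p m} fun m => by positivity
    _ = D * (1 - r)⁻¹ := by rw [tsum_mul_left, tsum_geometric_of_lt_one hr0 hr1]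

theorem tendsto_div_one_sub_rpow {q : ℝ} (hq0 : 0 < q) (hq1 : q < 1) :
    Tendsto (fun s : ℝ => s * (1 - q ^ s)⁻¹) (𝓝[>] 0) (𝓝 (-Real.log q)⁻¹) := by
  have hderiv : HasDerivAt (fun s : ℝ => 1 - q ^ s) (-Real.log q) 0 := by
    simpa using ((Real.hasStrictDerivAt_const_rpow hq0 0).hasDerivAt).const_sub 1
  have hlog : -Real.log q ≠ 0 := neg_ne_zero.mpr (Real.log_neg hq0 hq1).ne
  simpa [mul_comm] using hderiv.tendsto_slope_zero_right.inv₀ hlog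

theorem tendsto_mul_norm_qc_sub_mul_inv {q : ℝ} (hq0 : 0 < q) (hq1 : q < 1) (C a b : ℝ) :
    Tendsto (fun s : ℝ => s * (C * ‖qc q (s * a) - qc q (s * b)‖ * (1 - q ^ s)⁻¹))
      (𝓝[>] 0) (𝓝 0) := by
  have hcont (x : ℝ) : Continuous fun s : ℝ => qc q (s * x) :=
    Complex.continuous_ofReal.comp
      ((Real.continuous_const_rpow hq0.ne').comp (continuous_mul_const x))
  have hdiff : Tendsto (fun s : ℝ => C * ‖qc q (s * a) - qc q (s * b)‖) (𝓝[>] 0) (𝓝 0) := by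
    have hdiff_cont : Continuous fun s : ℝ => C * ‖qc q (s * a) - qc q (s * b)‖ :=
      continuous_const.mul ((hcont a).sub (hcont b)).norm
    have hlim := hdiff_cont.tendsto 0
    simp only [zero_mul, sub_self, norm_zero, mul_zero] at hlim
    exact hlim.mono_left nhdsWithin_le_nhds
  have hprod := hdiff.mul (tendsto_div_one_sub_rpow hq0 hq1)
  rw [zero_mul] at hprod
  exact hprod.congr fun s => by ring

/-- component of claim (2) on the band region `k = n + m`, `-l₁ < k < l₁`. -/
theorem stmt10 (q : ℝ) (hq0 : 0 < q) (hq1 : q < 1) (c α : ℂ)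
    (hc : ‖c‖ = 1) (hα : ‖α‖ = 1) (l₁ : ℤ) (hl₁ : 0 < l₁)
    (l : ℤ) (hl : |l| < l₁) (N : ℤ) (hN : 2 * l₁ < N) (v : ℤ → ℂ)
    (d : ℕ → ℂ) (hd : IsAdmissibleSeq q c l₁ d)
    (T : ℝ → ℤ → ℕ → ℂ)
    (hT : ∀ (s : ℝ) (k : ℤ) (m : ℕ),
      T s k m = qc q (-(m : ℝ)) * d m * qc q ((m : ℝ) / 2) * c ^ (-(m : ℤ)) * v k *
        (qc q (s * (((|k + l| : ℤ) : ℝ) + (m : ℝ) - (k : ℝ) - (l : ℝ))) -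
         qc q (s * (((|k| : ℤ) : ℝ) + (m : ℝ) - (k : ℝ))))) :
    (∀ s : ℝ, 0 < s → ∀ k ∈ Finset.Ioo (-l₁) l₁,
      Summable fun m : {m : ℕ // max N (k + l₁) ≤ (m : ℤ)} => ‖T s k m.1‖) ∧
    Tendsto (fun s : ℝ => (s : ℂ) *
        ∑ k ∈ Finset.Ioo (-l₁) l₁,
          ∑' m : {m : ℕ // max N (k + l₁) ≤ (m : ℤ)}, T s k m.1)
      (𝓝[>] (0 : ℝ)) (𝓝 0) := by
  obtain ⟨C, hC⟩ := hd.exists_norm_le hq0 hc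
  let a (k : ℤ) : ℝ := ((|k + l| : ℤ) : ℝ) - k - l
  let b (k : ℤ) : ℝ := ((|k| : ℤ) : ℝ) - k
  let D (s : ℝ) (k : ℤ) : ℝ := |C| * ‖v k‖ * ‖qc q (s * a k) - qc q (s * b k)‖
  have hbound (s : ℝ) (k : ℤ) (m : {m : ℕ // max N (k + l₁) ≤ (m : ℤ)}) :
      ‖T s k m.1‖ ≤ D s k * (q ^ s) ^ m.1 := by
    obtain ⟨m, hm⟩ := m
    have hCm := (hC m (by have := (le_max_left _ _).trans hm; lia)).trans (le_abs_self C)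
    have ha : s * (((|k + l| : ℤ) : ℝ) + (m : ℝ) - (k : ℝ) - (l : ℝ)) = s * m + s * a k := by
      ring
    have hb : s * (((|k| : ℤ) : ℝ) + (m : ℝ) - (k : ℝ)) = s * m + s * b k := by
      ring
    rw [hT, ha, hb, ← qc_mul hq0, ← qc_mul hq0, ← mul_sub, norm_mul, norm_mul, norm_mul,
      norm_mul (qc q (s * m)), norm_qc hq0 (s * m), Real.rpow_mul_natCast hq0.le, norm_zpow, hc,
      one_zpow, mul_one]
    calc _ ≤ |C| * ‖v k‖ * ((q ^ s) ^ m * ‖qc q (s * a k) - qc q (s * b k)‖) := by gcongr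
      _ = D s k * (q ^ s) ^ m := by ring
  have hgeom (s : ℝ) (hs : 0 < s) (k : ℤ) :=
    summable_norm_and_norm_tsum_le_of_geometric (by positivity : 0 ≤ D s k)
      (Real.rpow_nonneg hq0.le s) (Real.rpow_lt_one hq0.le hq1 hs) (hbound s k)
  refine ⟨fun s hs k _ => (hgeom s hs k).1, ?_⟩
  simp only [Finset.mul_sum]
  suffices hterm : ∀ k ∈ Finset.Ioo (-l₁) l₁, Tendsto (fun s : ℝ => (s : ℂ) *
      ∑' m : {m : ℕ // max N (k + l₁) ≤ (m : ℤ)}, T s k m.1) (𝓝[>] (0 : ℝ)) (𝓝 0) by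
    simpa only [Finset.sum_const_zero] using tendsto_finsetSum _ hterm
  intro k _
  refine squeeze_zero_norm' ?_
    (tendsto_mul_norm_qc_sub_mul_inv hq0 hq1 (|C| * ‖v k‖) (a k) (b k))
  filter_upwards [self_mem_nhdsWithin] with s hs
  have hs : 0 < s := hs
  rw [norm_mul, Complex.norm_real, Real.norm_of_nonneg hs.le]
  exact mul_le_mul_of_nonneg_left (hgeom s hs k).2 hs.le
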